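/- arXiv:1812.03207 — 3 statements merged into one kernel-verified Lean document; each statement's English description precedes it below -/
import Mathlib

section
/- Let n ≥ 2, let k be an integer with 2 ≤ k ≤ n, and set c_{n,k} = (1/n)·binom(n,k). Let B ⊆ ℝⁿ be the open ball of radius R > 0 centered at the origin, and let θ be a radially symmetric solution of problem (★) on B (i.e. θ(x) = g(|x|) for some function g, with g convex and g' attaining its maximum at r = R). Then sup_B |θ| ≤ [ (2R)^k vol(B) / (ω_n R^{n−k} (k−1) c_{n,k}) ]^{1/(k−1)}, where ω_n is the volume of the unit ball in ℝⁿ and vol(B) = ω_n Rⁿ. -/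
open scoped BigOperators
open Metric Set MeasureTheory Filter

noncomputable section

/-- The Hessian matrix of a real-valued function `u` at the point `x`,
whose `(i,j)` entry is `∂²u/∂xᵢ∂xⱼ (x)`. -/
def hessianMatrix (n : ℕ) (u : EuclideanSpace ℝ (Fin n) → ℝ)
    (x : EuclideanSpace ℝ (Fin n)) : Matrix (Fin n) (Fin n) ℝ :=
  Matrix.of fun i j =>
    iteratedFDeriv ℝ 2 u x ![EuclideanSpace.single i (1 : ℝ), EuclideanSpace.single j (1 : ℝ)]

/-- Sum of all `k × k` principal minors of an `n × n` matrix; for a symmetric matrix this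
is the `k`-th elementary symmetric function of its eigenvalues. -/
def sumPrincipalMinors (n k : ℕ) (A : Matrix (Fin n) (Fin n) ℝ) : ℝ :=
  ∑ s ∈ (Finset.univ : Finset (Fin n)).powersetCard k,
    (A.submatrix (fun i : {i // i ∈ s} => (i : Fin n))
      (fun i : {i // i ∈ s} => (i : Fin n))).det

/-- The `k`-Hessian operator `S_k(D²u)(x)`. -/
def SkHess (n k : ℕ) (u : EuclideanSpace ℝ (Fin n) → ℝ)
    (x : EuclideanSpace ℝ (Fin n)) : ℝ :=
  sumPrincipalMinors n k (hessianMatrix n u x)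

/-- `u` is `k`-admissible on the bounded open set `Ω`:
`u ∈ C²(Ω) ∩ C(Ω̄)` and `S_j(D²u) > 0` in `Ω` for every `j = 1, …, k`. -/
def KAdmissible (n k : ℕ) (Ω : Set (EuclideanSpace ℝ (Fin n)))
    (u : EuclideanSpace ℝ (Fin n) → ℝ) : Prop :=
  ContDiffOn ℝ 2 u Ω ∧ ContinuousOn u (closure Ω) ∧
    ∀ j, 1 ≤ j → j ≤ k → ∀ x ∈ Ω, 0 < SkHess n j u x

/-- `θ` is a solution of problem (★) on `Ω`:
`θ` is `k`-admissible, `θ < 0` in `Ω`, `θ = 0` on `∂Ω` and `S_k(D²θ) = -θ/(k-1)` in `Ω`. -/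
def IsStarSolution (n k : ℕ) (Ω : Set (EuclideanSpace ℝ (Fin n)))
    (θ : EuclideanSpace ℝ (Fin n) → ℝ) : Prop :=
  KAdmissible n k Ω θ ∧ (∀ x ∈ Ω, θ x < 0) ∧ (∀ x ∈ frontier Ω, θ x = 0) ∧
    ∀ x ∈ Ω, SkHess n k θ x = -θ x / ((k : ℝ) - 1)

/-- `u : [0,∞) × Ω̄ → ℝ` is a classical solution of problem (P):
`∂ₜu = S_k(D²u)` in `(0,∞) × Ω`, `u(t,·)` is `k`-admissible for each `t ≥ 0`,
and `u = 0` on `[0,∞) × ∂Ω`. -/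
def IsSolutionP (n k : ℕ) (Ω : Set (EuclideanSpace ℝ (Fin n)))
    (u : ℝ → EuclideanSpace ℝ (Fin n) → ℝ) : Prop :=
  (∀ t : ℝ, 0 < t → ∀ x ∈ Ω, HasDerivAt (fun s => u s x) (SkHess n k (u t) x) t) ∧
    (∀ t : ℝ, 0 ≤ t → KAdmissible n k Ω (u t)) ∧
    (∀ t : ℝ, 0 ≤ t → ∀ x ∈ frontier Ω, u t x = 0)

/-- `sup_Ω |θ|`. -/
def supAbs (n : ℕ) (Ω : Set (EuclideanSpace ℝ (Fin n)))
    (θ : EuclideanSpace ℝ (Fin n) → ℝ) : ℝ :=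
  sSup ((fun x => |θ x|) '' Ω)

lemma det_ge_aux {ι : Type*} [Fintype ι] [DecidableEq ι] (A : Matrix ι ι ℝ) (a : ℝ) (ha : 0 ≤ a)
    (hA : A.IsHermitian) (h : (A - a • (1 : Matrix ι ι ℝ)).PosSemidef) :
    a ^ (Fintype.card ι) ≤ A.det := by
  rw [hA.det_eq_prod_eigenvalues]
  have key : ∀ i, a ≤ hA.eigenvalues i := by
    intro i
    have h1 := h.dotProduct_mulVec_nonneg (hA.eigenvectorBasis i)
    have h2 : (star ⇑(hA.eigenvectorBasis i)) ⬝ᵥ (⇑(hA.eigenvectorBasis i) : ι → ℝ) = 1 := by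
      have h3 := hA.eigenvectorBasis.orthonormal.1 i
      have h4 : inner ℝ (hA.eigenvectorBasis i) (hA.eigenvectorBasis i) = (1 : ℝ) := by
        rw [real_inner_self_eq_norm_sq, h3]; norm_num
      rw [EuclideanSpace.inner_eq_star_dotProduct] at h4
      rw [dotProduct_comm]; exact h4
    rw [Matrix.sub_mulVec, hA.mulVec_eigenvectorBasis, Matrix.smul_mulVec, Matrix.one_mulVec,
      dotProduct_sub, dotProduct_smul, dotProduct_smul, h2] at h1
    simpa using h1
  calc a ^ (Fintype.card ι) = ∏ _i : ι, a := by simp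
    _ ≤ ∏ i, hA.eigenvalues i := Finset.prod_le_prod (fun _ _ => ha) (fun i _ => key i)
    _ = _ := by simp

lemma minors_ge_aux (n k : ℕ) (A : Matrix (Fin n) (Fin n) ℝ) (a : ℝ) (ha : 0 ≤ a)
    (hA : A.IsHermitian) (h : (A - a • (1 : Matrix (Fin n) (Fin n) ℝ)).PosSemidef) :
    (n.choose k : ℝ) * a ^ k ≤ sumPrincipalMinors n k A := by
  unfold sumPrincipalMinors
  have hc : (n.choose k : ℝ) * a ^ k
      = ∑ s ∈ (Finset.univ : Finset (Fin n)).powersetCard k, a ^ k := by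
    simp
  rw [hc]
  refine Finset.sum_le_sum fun s hs => ?_
  have hcard : Fintype.card {i // i ∈ s} = k := by
    simpa using (Finset.mem_powersetCard.1 hs).2
  rw [← hcard]
  refine det_ge_aux _ a ha (hA.submatrix _) ?_
  have := h.submatrix (fun i : {i // i ∈ s} => (i : Fin n))
  convert this using 1
  ext i j
  simp only [Matrix.sub_apply, Matrix.smul_apply, Matrix.submatrix_apply, Matrix.one_apply,
    Subtype.coe_inj]

lemma second_deriv_aux (φ : ℝ → ℝ) (hm : IsLocalMin φ 0) (hc : ContinuousAt φ 0) :
    0 ≤ deriv (deriv φ) 0 := by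
  by_contra! hneg
  have hd : deriv φ 0 = 0 := hm.deriv_eq_zero
  have hM := isLocalMax_of_deriv_deriv_neg hneg hd hc
  have heq : φ =ᶠ[nhds 0] fun _ => φ 0 := by
    filter_upwards [hm, hM] with t h1 h2
    exact le_antisymm h2 h1
  have h0 : deriv (deriv φ) 0 = 0 := by
    rw [heq.deriv.deriv_eq]; simp
  linarith

lemma hess_aux {E : Type*} [NormedAddCommGroup E] [InnerProductSpace ℝ E]
    (θ : E → ℝ) (x : E) (hθ : ContDiffAt ℝ 2 θ x) (a : ℝ)
    (hm : IsLocalMin (fun y => θ y - a / 2 * ‖y‖ ^ 2) x) (v : E) :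
    a * ‖v‖ ^ 2 ≤ fderiv ℝ (fderiv ℝ θ) x v v := by
  set L : ℝ → E := fun t => x + t • v with hL
  have hL0 : L 0 = x := by simp [hL]
  have hLd : ∀ t, HasDerivAt L v t := fun t => by
    have h := ((hasDerivAt_id t).smul_const v).const_add x
    rw [one_smul] at h
    exact h
  have hLc : Tendsto L (nhds 0) (nhds x) := by
    have := (hLd 0).continuousAt.tendsto
    rwa [hL0] at this
  set φ : ℝ → ℝ := fun t => θ (L t) - a / 2 * ‖L t‖ ^ 2 with hφ
  have hmin : IsLocalMin φ 0 := by
    have := hLc.eventually hm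
    filter_upwards [this] with t ht
    simpa [hφ, hL0] using ht
  have hdiff : ∀ᶠ y in nhds x, DifferentiableAt ℝ θ y := by
    filter_upwards [hθ.eventually (by simp)] with y hy
    exact hy.differentiableAt (by simp)
  have hd1 : ∀ᶠ t in nhds (0 : ℝ), HasDerivAt φ (fderiv ℝ θ (L t) v - a * inner ℝ (L t) v) t := by
    filter_upwards [hLc.eventually hdiff] with t ht
    have h1 := ht.hasFDerivAt.comp_hasDerivAt t (hLd t)
    have h2 := ((hLd t).norm_sq).const_mul (a / 2)
    have h3 := h1.sub h2
    have e : fderiv ℝ θ (L t) v - a * inner ℝ (L t) v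
        = fderiv ℝ θ (L t) v - a / 2 * (2 * inner ℝ (L t) v) := by ring
    rw [e]
    exact h3
  have hd1' : deriv φ =ᶠ[nhds 0] fun t => fderiv ℝ θ (L t) v - a * inner ℝ (L t) v := by
    filter_upwards [hd1] with t ht using ht.deriv
  have hF : DifferentiableAt ℝ (fderiv ℝ θ) (L 0) := by
    rw [hL0]
    exact (hθ.fderiv_right (m := 1) (by norm_num)).differentiableAt (by simp)
  have hd2 : HasDerivAt (fun t => fderiv ℝ θ (L t) v - a * inner ℝ (L t) v)
      (fderiv ℝ (fderiv ℝ θ) x v v - a * ‖v‖ ^ 2) 0 := by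
    have h1 := hF.hasFDerivAt.comp_hasDerivAt (0 : ℝ) (hLd 0)
    have h1' := h1.clm_apply (hasDerivAt_const (0 : ℝ) v)
    have h2 := ((hLd 0).inner ℝ (hasDerivAt_const (0 : ℝ) v)).const_mul a
    have h3 := h1'.sub h2
    have e : fderiv ℝ (fderiv ℝ θ) x v v - a * ‖v‖ ^ 2 =
        fderiv ℝ (fderiv ℝ θ) (L 0) v v + ((fderiv ℝ θ ∘ L) 0) 0
          - a * (inner ℝ (L 0) 0 + inner ℝ v v) := by
      rw [hL0]
      simp
    rw [e]
    exact h3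
  have hnn := second_deriv_aux φ hmin (hd1.self_of_nhds).continuousAt
  rw [hd1'.deriv_eq, hd2.deriv] at hnn
  linarith

lemma quad_aux {n : ℕ} (B : EuclideanSpace ℝ (Fin n) →L[ℝ] EuclideanSpace ℝ (Fin n) →L[ℝ] ℝ)
    (w : Fin n → ℝ) :
    w ⬝ᵥ (Matrix.mulVec (Matrix.of fun i j => B (EuclideanSpace.single i (1 : ℝ))
      (EuclideanSpace.single j (1 : ℝ))) w) = B (WithLp.toLp 2 w) (WithLp.toLp 2 w) := by
  have hw : WithLp.toLp 2 w = ∑ i, w i • EuclideanSpace.single i (1 : ℝ) := by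
    ext j
    simp [Finset.sum_apply, Pi.single_apply]
  rw [hw]
  simp only [map_sum, _root_.sum_apply, map_smul, _root_.smul_apply,
    dotProduct, Matrix.mulVec, Matrix.of_apply, smul_eq_mul, Finset.mul_sum]
  rw [Finset.sum_comm]
  refine Finset.sum_congr rfl fun i _ => Finset.sum_congr rfl fun j _ => ?_
  ring

lemma SkHess_ge_aux (n k : ℕ) (θ : EuclideanSpace ℝ (Fin n) → ℝ) (x : EuclideanSpace ℝ (Fin n))
    (hθ : ContDiffAt ℝ 2 θ x) (a : ℝ) (ha : 0 ≤ a)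
    (hm : IsLocalMin (fun y => θ y - a / 2 * ‖y‖ ^ 2) x) :
    (n.choose k : ℝ) * a ^ k ≤ SkHess n k θ x := by
  have hs : IsSymmSndFDerivAt ℝ θ x := hθ.isSymmSndFDerivAt (by simp)
  have hH : hessianMatrix n θ x = Matrix.of fun i j =>
      fderiv ℝ (fderiv ℝ θ) x (EuclideanSpace.single i (1 : ℝ))
        (EuclideanSpace.single j (1 : ℝ)) := by
    ext i j
    simp [hessianMatrix, iteratedFDeriv_two_apply]
  have hherm : (hessianMatrix n θ x).IsHermitian := by
    rw [hH]
    ext i j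
    simpa using hs _ _
  refine minors_ge_aux n k _ a ha hherm ?_
  refine Matrix.PosSemidef.of_dotProduct_mulVec_nonneg ?_ ?_
  · refine hherm.sub ?_
    ext i j
    simp [Matrix.one_apply, eq_comm]
  · intro w
    have h1 := hess_aux θ x hθ a hm (WithLp.toLp 2 w)
    rw [← quad_aux, ← hH] at h1
    have h2 : ‖(WithLp.toLp 2 w : EuclideanSpace ℝ (Fin n))‖ ^ 2 = w ⬝ᵥ w := by
      rw [EuclideanSpace.norm_sq_eq]
      simp [dotProduct, sq]
    rw [h2] at h1
    rw [Matrix.sub_mulVec, Matrix.smul_mulVec, Matrix.one_mulVec, dotProduct_sub, dotProduct_smul]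
    simpa using h1

/-- explicit bound on a ball: if `θ` is a radially symmetric solution of (★)
on `B = B(0,R)` (θ(x) = g(|x|) with `g` convex whose derivative is maximal at `r = R`),
then `sup_B|θ| ≤ [(2R)^k vol(B) / (ωₙ R^{n-k}(k-1)c_{n,k})]^{1/(k-1)}`. -/
theorem stmt_13 (n k : ℕ) (hn : 2 ≤ n) (hk : 2 ≤ k) (hkn : k ≤ n)
    (R : ℝ) (hR : 0 < R)
    (θ : EuclideanSpace ℝ (Fin n) → ℝ)
    (hθ : IsStarSolution n k (Metric.ball (0 : EuclideanSpace ℝ (Fin n)) R) θ)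
    (g : ℝ → ℝ)
    (hrad : ∀ x ∈ closure (Metric.ball (0 : EuclideanSpace ℝ (Fin n)) R), θ x = g ‖x‖)
    (hconv : ConvexOn ℝ (Icc (0 : ℝ) R) g)
    (hgrad : ∀ r ∈ Icc (0 : ℝ) R, deriv g r ≤ deriv g R) :
    supAbs n (Metric.ball (0 : EuclideanSpace ℝ (Fin n)) R) θ ≤
      (((2 * R) ^ k * (volume (Metric.ball (0 : EuclideanSpace ℝ (Fin n)) R)).toReal) /
          ((volume (Metric.ball (0 : EuclideanSpace ℝ (Fin n)) 1)).toReal *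
            R ^ (n - k) * ((k : ℝ) - 1) * ((1 : ℝ) / (n : ℝ) * (n.choose k : ℝ)))) ^
        ((1 : ℝ) / ((k : ℝ) - 1)) := by
  obtain ⟨⟨hC2, hcont, -⟩, hneg, hbd, heq⟩ := hθ
  have hcl : closure (Metric.ball (0 : EuclideanSpace ℝ (Fin n)) R) = closedBall 0 R :=
    closure_ball _ hR.ne'
  have hfr : frontier (Metric.ball (0 : EuclideanSpace ℝ (Fin n)) R) = sphere 0 R :=
    frontier_ball _ hR.ne'
  rw [hcl] at hcont
  rw [hfr] at hbd
  have hk1 : (1 : ℝ) ≤ (k : ℝ) - 1 := by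
    have : (2 : ℝ) ≤ k := by exact_mod_cast hk
    linarith
  have hnpos : (0 : ℝ) < n := by positivity
  have hchoose : (0 : ℝ) < (n.choose k : ℝ) := by exact_mod_cast Nat.choose_pos hkn
  -- boundedness
  have hcomp := isCompact_closedBall (0 : EuclideanSpace ℝ (Fin n)) R
  have hbdd : BddAbove ((fun x => |θ x|) '' Metric.ball (0 : EuclideanSpace ℝ (Fin n)) R) :=
    (hcomp.bddAbove_image hcont.abs).mono (image_mono ball_subset_closedBall)
  set M := supAbs n (Metric.ball (0 : EuclideanSpace ℝ (Fin n)) R) θ with hMdef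
  have hle : ∀ x ∈ Metric.ball (0 : EuclideanSpace ℝ (Fin n)) R, |θ x| ≤ M := fun x hx =>
    le_csSup hbdd ⟨x, hx, rfl⟩
  have h0 : (0 : EuclideanSpace ℝ (Fin n)) ∈ Metric.ball (0 : EuclideanSpace ℝ (Fin n)) R :=
    mem_ball_self hR
  have hMpos : 0 < M := lt_of_lt_of_le (abs_pos.2 (hneg 0 h0).ne) (hle 0 h0)
  -- volume
  have hvol : (volume (Metric.ball (0 : EuclideanSpace ℝ (Fin n)) R)).toReal
      = R ^ n * (volume (Metric.ball (0 : EuclideanSpace ℝ (Fin n)) 1)).toReal := by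
    rw [Measure.addHaar_ball_of_pos volume _ hR, ENNReal.toReal_mul,
      ENNReal.toReal_ofReal (by positivity)]
    simp
  have hω : 0 < (volume (Metric.ball (0 : EuclideanSpace ℝ (Fin n)) 1)).toReal :=
    ENNReal.toReal_pos (measure_ball_pos _ _ one_pos).ne' measure_ball_lt_top.ne
  rw [hvol]
  set ω := (volume (Metric.ball (0 : EuclideanSpace ℝ (Fin n)) 1)).toReal
  have hX : ((2 * R) ^ k * (R ^ n * ω)) /
      (ω * R ^ (n - k) * ((k : ℝ) - 1) * ((1 : ℝ) / (n : ℝ) * (n.choose k : ℝ)))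
      = (2 ^ k * n) * (R ^ k * R ^ k / (((k : ℝ) - 1) * n.choose k)) := by
    have hRn : R ^ n = R ^ (n - k) * R ^ k := by rw [← pow_add]; congr 1; omega
    have : (k : ℝ) - 1 ≠ 0 := by positivity
    rw [hRn, mul_pow]
    field_simp
  rw [hX]
  set Y := R ^ k * R ^ k / (((k : ℝ) - 1) * n.choose k) with hY
  have hYpos : 0 < Y := by positivity
  by_contra! hcon
  have hXM : (2 ^ k * n) * Y < M ^ (k - 1) := by
    have h1 := Real.rpow_lt_rpow (by positivity) hcon (show (0 : ℝ) < (k : ℝ) - 1 by linarith)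
    rw [← Real.rpow_mul (by positivity), one_div, inv_mul_cancel₀ (by linarith), Real.rpow_one] at h1
    have h2 : M ^ ((k : ℝ) - 1) = M ^ (k - 1) := by
      rw [← Real.rpow_natCast, Nat.cast_sub (by omega)]; simp
    rwa [h2] at h1
  have hYM : Y < M ^ (k - 1) := by
    refine lt_of_le_of_lt ?_ hXM
    have h1 : (1 : ℝ) ≤ 2 ^ k := one_le_pow₀ (by norm_num)
    have h2 : (1 : ℝ) ≤ n := by exact_mod_cast (by omega : 1 ≤ n)
    have : (1 : ℝ) ≤ 2 ^ k * n := by nlinarith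
    nlinarith
  set a := M / R ^ 2 with ha
  have hapos : 0 < a := by positivity
  have hbig : M / ((k : ℝ) - 1) < (n.choose k : ℝ) * a ^ k := by
    have hMk : M ^ k = M ^ (k - 1) * M := by rw [← pow_succ]; congr 1; omega
    have hkp : (0 : ℝ) < (k : ℝ) - 1 := by linarith
    have e1 : (n.choose k : ℝ) * a ^ k
        = M / ((k : ℝ) - 1) * (M ^ (k - 1) / Y) := by
      rw [ha, hY, div_pow, hMk, ← pow_mul, mul_comm 2 k, mul_two, pow_add]
      field_simp
    rw [e1]
    have : 1 < M ^ (k - 1) / Y := (one_lt_div hYpos).2 hYM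
    exact lt_mul_of_one_lt_right (by positivity) this
  -- comparison
  have hf : ContinuousOn (fun y => θ y - a / 2 * ‖y‖ ^ 2)
      (closedBall (0 : EuclideanSpace ℝ (Fin n)) R) :=
    hcont.sub (by fun_prop)
  obtain ⟨z, hz, hzmin⟩ := hcomp.exists_isMinOn ⟨0, ball_subset_closedBall h0⟩ hf
  have hzS : z ∈ sphere (0 : EuclideanSpace ℝ (Fin n)) R := by
    by_contra hzn
    have hzb : z ∈ Metric.ball (0 : EuclideanSpace ℝ (Fin n)) R := by
      rw [mem_ball]
      exact lt_of_le_of_ne (mem_closedBall.1 hz) hzn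
    have hnb := isOpen_ball.mem_nhds hzb
    have hloc : IsLocalMin (fun y => θ y - a / 2 * ‖y‖ ^ 2) z :=
      hzmin.isLocalMin (mem_of_superset hnb ball_subset_closedBall)
    have h1 := SkHess_ge_aux n k θ z (hC2.contDiffAt hnb) a hapos.le hloc
    rw [heq z hzb] at h1
    have h2 : -θ z ≤ M := (neg_le_abs _).trans (hle z hzb)
    have h3 : -θ z / ((k : ℝ) - 1) ≤ M / ((k : ℝ) - 1) :=
      div_le_div_of_nonneg_right h2 (by linarith)
    linarith
  have hzn : ‖z‖ = R := by simpa using hzS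
  have hfin : M ≤ M / 2 := by
    refine csSup_le ⟨_, 0, h0, rfl⟩ ?_
    rintro _ ⟨x, hx, rfl⟩
    have h1 : θ z - a / 2 * ‖z‖ ^ 2 ≤ θ x - a / 2 * ‖x‖ ^ 2 := hzmin (ball_subset_closedBall hx)
    rw [hbd z hzS, hzn] at h1
    have h2 : a / 2 * R ^ 2 = M / 2 := by rw [ha]; field_simp
    have h3 : 0 ≤ a / 2 * ‖x‖ ^ 2 := by positivity
    show |θ x| ≤ M / 2
    rw [abs_of_neg (hneg x hx)]
    linarith
  linarith
end
end

section
/- Let n ≥ 2, let k be an integer with 2 ≤ k ≤ n, and set c_{n,k} = (1/n)·binom(n,k), α = n/(n(k−1)+2k), β = 1/(n(k−1)+2k) and γ = ((k−1)/(2k))·(β/c_{n,k})^{1/k}. For C > 0, define the k-Barenblatt function U_C(t,x) = t^{−α} ( C − γ |x|² / t^{2β} )₊^{k/(k−1)} for t > 0 and x ∈ ℝⁿ, where (·)₊ denotes the positive part. Then U_C satisfies ∂_t U_C = (−1)^{k−1} S_k(D²U_C) (Hessian in x) classically at every point (t,x) with t > 0 and γ|x|²/t^{2β} ≠ C; moreover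 U_C(t,x) > 0 exactly when γ|x|² < C t^{2β}, so that the support of U_C(t,·) is the closed ball of radius t^{β} (C/γ)^{1/2} centered at the origin. -/
open scoped BigOperators
open Metric Set MeasureTheory Filter

noncomputable section

lemma det_scal_rank_one {m : Type*} [Fintype m] [DecidableEq m] (a b : ℝ) (ha : a ≠ 0)
    (v : m → ℝ) :
    (Matrix.of fun i j : m => a * (if i = j then 1 else 0) + b * (v i * v j)).det
      = a ^ Fintype.card m * (1 + b / a * ∑ i, v i ^ 2) := by
  have h : (Matrix.of fun i j : m => a * (if i = j then 1 else 0) + b * (v i * v j))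
      = a • (1 + Matrix.replicateCol Unit (fun i => b / a * v i) * Matrix.replicateRow Unit v) := by
    ext i j
    simp only [Matrix.of_apply, Matrix.smul_apply, Matrix.add_apply, Matrix.one_apply,
      Matrix.mul_apply, Matrix.replicateCol_apply, Matrix.replicateRow_apply, smul_eq_mul,
      Finset.univ_unique, Finset.sum_const, Finset.card_singleton, one_smul]
    field_simp
  rw [h, Matrix.det_smul, Matrix.det_one_add_replicateCol_mul_replicateRow]
  congr 2
  simp only [dotProduct, Finset.mul_sum]
  exact Finset.sum_congr rfl fun i _ => by ring

lemma sum_powersetCard_sum (n k : ℕ) (hk : 1 ≤ k) (f : Fin n → ℝ) :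
    ∑ s ∈ (Finset.univ : Finset (Fin n)).powersetCard k, ∑ i ∈ s, f i
      = ((n - 1).choose (k - 1) : ℝ) * ∑ i, f i := by
  have h1 : ∀ s ∈ (Finset.univ : Finset (Fin n)).powersetCard k,
      ∑ i ∈ s, f i = ∑ i, if {i} ⊆ s then f i else 0 := by
    intro s _
    rw [← Finset.sum_filter]
    simp
  rw [Finset.sum_congr rfl h1, Finset.sum_comm, Finset.mul_sum]
  refine Finset.sum_congr rfl fun i _ => ?_
  rw [← Finset.sum_filter, Finset.sum_const,
    Finset.card_filter_powersetCard_subset _ _ _ (by simp) (by simpa using hk)]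
  simp

lemma sumPM_scal_rank_one (n k : ℕ) (hk : 1 ≤ k) (hkn : k ≤ n) (a b : ℝ) (ha : a ≠ 0)
    (v : Fin n → ℝ) :
    sumPrincipalMinors n k
      (Matrix.of fun i j : Fin n => a * (if i = j then 1 else 0) + b * (v i * v j))
      = (n.choose k : ℝ) * a ^ (k - 1) * (a + b * ((k : ℝ) / n) * ∑ i, v i ^ 2) := by
  unfold sumPrincipalMinors
  have h1 : ∀ s ∈ (Finset.univ : Finset (Fin n)).powersetCard k,
      ((Matrix.of fun i j : Fin n => a * (if i = j then 1 else 0) + b * (v i * v j)).submatrix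
        (fun i : {i // i ∈ s} => (i : Fin n)) (fun i : {i // i ∈ s} => (i : Fin n))).det
      = a ^ k + a ^ (k - 1) * b * ∑ i ∈ s, v i ^ 2 := by
    intro s hs
    have := det_scal_rank_one a b ha (fun i : {i // i ∈ s} => v i)
    have hc : Fintype.card {i // i ∈ s} = k := by
      simpa using (Finset.mem_powersetCard.1 hs).2
    rw [hc] at this
    have e : (Matrix.of fun i j : Fin n =>
        a * (if i = j then 1 else 0) + b * (v i * v j)).submatrix
        (fun i : {i // i ∈ s} => (i : Fin n)) (fun i : {i // i ∈ s} => (i : Fin n))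
        = Matrix.of fun i j : {i // i ∈ s} =>
          a * (if i = j then 1 else 0) + b * (v i * v j) := by
      ext i j
      by_cases hij : i = j
      · simp [hij]
      · have hij2 : (i : Fin n) ≠ j := fun h => hij (Subtype.ext h)
        simp only [Matrix.submatrix_apply, Matrix.of_apply, if_neg hij, if_neg hij2]
    rw [e, this, ← Finset.sum_coe_sort s]
    generalize (∑ i : {i // i ∈ s}, v i ^ 2) = S
    clear e this hc hs
    obtain ⟨l, rfl⟩ : ∃ l, k = l + 1 := ⟨k - 1, by omega⟩
    rw [Nat.add_sub_cancel, pow_succ]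
    field_simp
  rw [Finset.sum_congr rfl h1, Finset.sum_add_distrib, ← Finset.mul_sum,
    sum_powersetCard_sum n k hk, Finset.sum_const, Finset.card_powersetCard]
  obtain ⟨l, rfl⟩ : ∃ l, k = l + 1 := ⟨k - 1, by omega⟩
  obtain ⟨m, rfl⟩ : ∃ l, n = l + 1 := ⟨n - 1, by omega⟩
  have := Nat.add_one_mul_choose_eq m l
  have h2 : ((m : ℝ) + 1) * (m.choose l : ℝ) = ((m + 1).choose (l + 1) : ℝ) * (l + 1) := by
    exact_mod_cast this
  have hm : (m : ℝ) + 1 ≠ 0 := by positivity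
  have h3 : (m.choose l : ℝ) = ((m + 1).choose (l + 1) : ℝ) * (l + 1) / (m + 1) := by
    rw [eq_div_iff hm, ← h2]; ring
  simp only [Nat.add_sub_cancel, h3, Finset.card_univ, Fintype.card_fin, nsmul_eq_mul]
  push_cast
  field_simp
  ring

lemma hess_profile (n : ℕ) (A C g m : ℝ) (x : EuclideanSpace ℝ (Fin n))
    (hx : 0 < C - g * ‖x‖ ^ 2) :
    hessianMatrix n (fun y => A * max (C - g * ‖y‖ ^ 2) 0 ^ m) x =
      Matrix.of fun i j : Fin n =>
        (-2 * g * m * A * (C - g * ‖x‖ ^ 2) ^ (m - 1)) * (if i = j then 1 else 0)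
        + (4 * g ^ 2 * m * (m - 1) * A * (C - g * ‖x‖ ^ 2) ^ (m - 2)) * (x i * x j) := by
  have hF : ∀ y : EuclideanSpace ℝ (Fin n), HasFDerivAt (fun y : EuclideanSpace ℝ (Fin n) => C - g * ‖y‖ ^ 2)
      (-(g • (2 • innerSL ℝ y))) y := fun y =>
    ((hasStrictFDerivAt_norm_sq y).hasFDerivAt.const_mul g).const_sub C
  have hev : ∀ y : EuclideanSpace ℝ (Fin n), 0 < C - g * ‖y‖ ^ 2 → ∀ᶠ z in nhds y, 0 < C - g * ‖z‖ ^ 2 :=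
    fun y hy => (hF y).continuousAt.eventually (lt_mem_nhds hy)
  have hf : ∀ y : EuclideanSpace ℝ (Fin n), 0 < C - g * ‖y‖ ^ 2 → ∀ w : EuclideanSpace ℝ (Fin n),
      fderiv ℝ (fun y : EuclideanSpace ℝ (Fin n) => A * max (C - g * ‖y‖ ^ 2) 0 ^ m) y w
        = -2 * g * m * A * ((C - g * ‖y‖ ^ 2) ^ (m - 1) * inner ℝ w y) := by
    intro y hy w
    have e : (fun y : EuclideanSpace ℝ (Fin n) => A * max (C - g * ‖y‖ ^ 2) 0 ^ m) =ᶠ[nhds y]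
        fun y : EuclideanSpace ℝ (Fin n) => A * (C - g * ‖y‖ ^ 2) ^ m := by
      filter_upwards [hev y hy] with z hz
      rw [max_eq_left hz.le]
    rw [e.fderiv_eq, (((hF y).rpow_const (p := m) (Or.inl hy.ne')).const_mul A).fderiv]
    simp [real_inner_comm]
    ring
  have hcd : ContDiffAt ℝ 2 (fun y : EuclideanSpace ℝ (Fin n) => A * max (C - g * ‖y‖ ^ 2) 0 ^ m) x := by
    have e : (fun y : EuclideanSpace ℝ (Fin n) => A * max (C - g * ‖y‖ ^ 2) 0 ^ m) =ᶠ[nhds x]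
        fun y : EuclideanSpace ℝ (Fin n) => A * (C - g * ‖y‖ ^ 2) ^ m := by
      filter_upwards [hev x hx] with z hz
      rw [max_eq_left hz.le]
    refine ContDiffAt.congr_of_eventuallyEq ?_ e
    refine contDiffAt_const.mul (ContDiffAt.rpow_const_of_ne ?_ hx.ne')
    exact contDiffAt_const.sub (contDiffAt_const.mul (contDiff_norm_sq ℝ).contDiffAt)
  have hdiff : DifferentiableAt ℝ (fderiv ℝ (fun y : EuclideanSpace ℝ (Fin n) => A * max (C - g * ‖y‖ ^ 2) 0 ^ m)) x :=
    (hcd.fderiv_right (m := 1) (by norm_num)).differentiableAt (by norm_num)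
  ext i j
  simp only [hessianMatrix, Matrix.of_apply, iteratedFDeriv_two_apply, Matrix.cons_val_zero,
    Matrix.cons_val_one]
  have key : fderiv ℝ (fderiv ℝ (fun y : EuclideanSpace ℝ (Fin n) => A * max (C - g * ‖y‖ ^ 2) 0 ^ m)) x
      (EuclideanSpace.single i 1) (EuclideanSpace.single j 1)
      = fderiv ℝ (fun y => fderiv ℝ (fun y : EuclideanSpace ℝ (Fin n) => A * max (C - g * ‖y‖ ^ 2) 0 ^ m) y
        (EuclideanSpace.single j 1)) x (EuclideanSpace.single i 1) := by
    rw [fderiv_clm_apply hdiff (differentiableAt_const _)]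
    simp
  rw [key]
  have e2 : (fun y => fderiv ℝ (fun y : EuclideanSpace ℝ (Fin n) => A * max (C - g * ‖y‖ ^ 2) 0 ^ m) y
        (EuclideanSpace.single j 1)) =ᶠ[nhds x]
      fun y => -2 * g * m * A * ((C - g * ‖y‖ ^ 2) ^ (m - 1) *
        innerSL ℝ (EuclideanSpace.single j (1 : ℝ) : EuclideanSpace ℝ (Fin n)) y) := by
    filter_upwards [hev x hx] with z hz
    rw [hf z hz]; rfl
  rw [e2.fderiv_eq, ((((hF x).rpow_const (p := m - 1) (Or.inl hx.ne')).fun_mul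
    (innerSL ℝ (EuclideanSpace.single j (1 : ℝ) : EuclideanSpace ℝ (Fin n))).hasFDerivAt).const_mul
      (-2 * g * m * A)).fderiv]
  have e3 : m - 1 - 1 = m - 2 := by ring
  simp [e3, EuclideanSpace.inner_single_right, EuclideanSpace.inner_single_left, Pi.single_apply]
  split_ifs <;> first | ring | (exfalso; simp_all; done) | skip
  
lemma hess_zero (n k : ℕ) (hk : 1 ≤ k) (A C g m : ℝ) (hm : m ≠ 0)
    (x : EuclideanSpace ℝ (Fin n))
    (hx : C - g * ‖x‖ ^ 2 < 0) :
    SkHess n k (fun y => A * max (C - g * ‖y‖ ^ 2) 0 ^ m) x = 0 := by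
  have hc : Continuous fun y : EuclideanSpace ℝ (Fin n) => C - g * ‖y‖ ^ 2 := by fun_prop
  have e : (fun y : EuclideanSpace ℝ (Fin n) => A * max (C - g * ‖y‖ ^ 2) 0 ^ m) =ᶠ[nhds x]
      fun _ => (0 : ℝ) := by
    filter_upwards [hc.continuousAt.eventually (gt_mem_nhds hx)] with z hz
    rw [max_eq_right hz.le, Real.zero_rpow hm, mul_zero]
  have h0 : hessianMatrix n (fun y => A * max (C - g * ‖y‖ ^ 2) 0 ^ m) x = 0 := by
    ext i j
    simp only [hessianMatrix, Matrix.of_apply]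
    rw [(e.iteratedFDeriv ℝ 2).self_of_nhds]
    simp
  unfold SkHess sumPrincipalMinors
  rw [h0]
  refine Finset.sum_eq_zero fun s hs => ?_
  have hc : s.card = k := (Finset.mem_powersetCard.1 hs).2
  have : Nonempty {i // i ∈ s} := by
    obtain ⟨i, hi⟩ := Finset.card_pos.1 (by omega : 0 < s.card)
    exact ⟨⟨i, hi⟩⟩
  simp [Matrix.det_zero]

/-- the `k`-Barenblatt function
`U_C(t,x) = t^{-α}(C - γ|x|²/t^{2β})₊^{k/(k-1)}` satisfies
`∂ₜU_C = (-1)^{k-1}S_k(D²U_C)` classically off the degeneracy surface, is positive exactly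
when `γ|x|² < C t^{2β}`, and `supp U_C(t,·)` is the closed ball of radius
`t^β (C/γ)^{1/2}`. -/
theorem stmt_18 (n k : ℕ) (hn : 2 ≤ n) (hk : 2 ≤ k) (hkn : k ≤ n) (C : ℝ) (hC : 0 < C) :
    let cnk : ℝ := (1 : ℝ) / (n : ℝ) * (n.choose k : ℝ)
    let α : ℝ := (n : ℝ) / ((n : ℝ) * ((k : ℝ) - 1) + 2 * (k : ℝ))
    let β : ℝ := 1 / ((n : ℝ) * ((k : ℝ) - 1) + 2 * (k : ℝ))
    let γ : ℝ := ((k : ℝ) - 1) / (2 * (k : ℝ)) * (β / cnk) ^ ((1 : ℝ) / (k : ℝ))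
    let U : ℝ → EuclideanSpace ℝ (Fin n) → ℝ := fun t x =>
      t ^ (-α) * max (C - γ * ‖x‖ ^ 2 / t ^ (2 * β)) 0 ^ ((k : ℝ) / ((k : ℝ) - 1))
    (∀ t : ℝ, 0 < t → ∀ x : EuclideanSpace ℝ (Fin n),
        γ * ‖x‖ ^ 2 / t ^ (2 * β) ≠ C →
        HasDerivAt (fun s : ℝ => U s x)
          ((-1 : ℝ) ^ (k - 1) * SkHess n k (U t) x) t) ∧
    (∀ t : ℝ, 0 < t → ∀ x : EuclideanSpace ℝ (Fin n),
        (0 < U t x ↔ γ * ‖x‖ ^ 2 < C * t ^ (2 * β))) ∧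
    (∀ t : ℝ, 0 < t →
        closure (Function.support (U t)) =
          Metric.closedBall (0 : EuclideanSpace ℝ (Fin n))
            (t ^ β * Real.sqrt (C / γ))) := by
  intro cnk α β γ U
  have hk2 : (2 : ℝ) ≤ k := by exact_mod_cast hk
  have hn2 : (2 : ℝ) ≤ n := by exact_mod_cast hn
  have hk1 : 0 < (k : ℝ) - 1 := by linarith
  have hk0 : 0 < (k : ℝ) := by linarith
  have hn0 : 0 < (n : ℝ) := by linarith
  have hch : 0 < (n.choose k : ℝ) := by exact_mod_cast Nat.choose_pos hkn
  have hD : 0 < (n : ℝ) * ((k : ℝ) - 1) + 2 * (k : ℝ) := by positivity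
  have hβ : 0 < β := by simp only [β]; positivity
  have hcnk : 0 < cnk := by simp only [cnk]; positivity
  have hγ : 0 < γ := by simp only [γ]; positivity
  have hα : α = n * β := by simp only [α, β]; ring
  have hm : 0 < (k : ℝ) / ((k : ℝ) - 1) := by positivity
  have hpos : ∀ t : ℝ, 0 < t → ∀ x : EuclideanSpace ℝ (Fin n),
        (0 < U t x ↔ γ * ‖x‖ ^ 2 < C * t ^ (2 * β)) := by
    intro t ht x
    have hT : 0 < t ^ (2 * β) := Real.rpow_pos_of_pos ht _
    have hA : 0 < t ^ (-α) := Real.rpow_pos_of_pos ht _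
    rw [← div_lt_iff₀ hT]
    simp only [U]
    constructor
    · intro h
      by_contra hc
      push Not at hc
      rw [max_eq_right (by linarith), Real.zero_rpow hm.ne', mul_zero] at h
      exact lt_irrefl _ h
    · intro h
      rw [max_eq_left (by linarith)]
      exact mul_pos hA (Real.rpow_pos_of_pos (by linarith) _)
  refine ⟨?_, hpos, ?_⟩
  · intro t ht x hx
    have hT : 0 < t ^ (2 * β) := Real.rpow_pos_of_pos ht _
    have hA : 0 < t ^ (-α) := Real.rpow_pos_of_pos ht _
    have hUt : U t = fun y => t ^ (-α) *
        max (C - (γ / t ^ (2 * β)) * ‖y‖ ^ 2) 0 ^ ((k : ℝ) / ((k : ℝ) - 1)) := by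
      funext y
      simp only [U]
      rw [mul_div_right_comm]
    have hFt : HasDerivAt (fun s : ℝ => C - γ * ‖x‖ ^ 2 / s ^ (2 * β))
        (2 * β * (γ / t ^ (2 * β)) * ‖x‖ ^ 2 / t) t := by
      have h1 := (Real.hasDerivAt_rpow_const (x := t) (p := 2 * β) (Or.inl ht.ne'))
      have h2 := ((hasDerivAt_const t (γ * ‖x‖ ^ 2)).div h1 hT.ne').const_sub C
      refine HasDerivAt.congr_deriv h2 ?_
      rw [Real.rpow_sub_one ht.ne']
      field_simp
      ring
    rcases lt_or_gt_of_ne hx with hlt | hgt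
    · have hF : 0 < C - (γ / t ^ (2 * β)) * ‖x‖ ^ 2 := by
        rw [div_mul_eq_mul_div]; linarith
      have e : (fun s => U s x) =ᶠ[nhds t] fun s => s ^ (-α) *
          (C - γ * ‖x‖ ^ 2 / s ^ (2 * β)) ^ ((k : ℝ) / ((k : ℝ) - 1)) := by
        filter_upwards [hFt.continuousAt.eventually
          (lt_mem_nhds (show 0 < C - γ * ‖x‖ ^ 2 / t ^ (2 * β) by linarith))] with s hs
        simp only [U]
        rw [max_eq_left hs.le]
      refine HasDerivAt.congr_of_eventuallyEq ?_ e
      have hd := (Real.hasDerivAt_rpow_const (x := t) (p := -α) (Or.inl ht.ne')).mul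
        (hFt.rpow_const (p := (k : ℝ) / ((k : ℝ) - 1))
          (Or.inl (show C - γ * ‖x‖ ^ 2 / t ^ (2 * β) ≠ 0 by linarith)))
      refine hd.congr_deriv ?_
      have hAK : (t ^ (-α) / t ^ (2 * β)) ^ k = t ^ (-α) / t := by
        rw [← Real.rpow_sub ht, ← Real.rpow_natCast, ← Real.rpow_mul ht.le,
          ← Real.rpow_sub_one ht.ne']
        congr 1
        simp only [α, β]
        field_simp
        ring
      have hgK : (2 * γ * ((k : ℝ) / ((k : ℝ) - 1))) ^ k = β / cnk := by
        have : 2 * γ * ((k : ℝ) / ((k : ℝ) - 1)) = (β / cnk) ^ ((1 : ℝ) / (k : ℝ)) := by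
          simp only [γ]
          field_simp
        rw [this, ← Real.rpow_natCast, ← Real.rpow_mul (by positivity),
          one_div_mul_cancel hk0.ne', Real.rpow_one]
      have hK : (n.choose k : ℝ) * (2 * (γ / t ^ (2 * β)) * ((k : ℝ) / ((k : ℝ) - 1))
          * t ^ (-α)) ^ k = n * β * (t ^ (-α) / t) := by
        have : 2 * (γ / t ^ (2 * β)) * ((k : ℝ) / ((k : ℝ) - 1)) * t ^ (-α)
            = (2 * γ * ((k : ℝ) / ((k : ℝ) - 1))) * (t ^ (-α) / t ^ (2 * β)) := by
          ring
        rw [this, mul_pow, hAK, hgK]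
        simp only [cnk]
        field_simp
      have hX : ∑ i, x i ^ 2 = ‖x‖ ^ 2 := by
        rw [EuclideanSpace.real_norm_sq_eq]
      rw [SkHess, hUt, hess_profile n _ C _ _ x hF,
        sumPM_scal_rank_one n k (by omega) hkn _ _ (by
          have := Real.rpow_pos_of_pos hF ((k : ℝ) / ((k : ℝ) - 1) - 1)
          refine mul_ne_zero ?_ this.ne'
          have : 0 < γ / t ^ (2 * β) := by positivity
          simp only [neg_mul]
          exact neg_ne_zero.2 (by positivity)), hX, mul_div_right_comm γ, Real.rpow_sub_one ht.ne']
      have hQ1 : (C - (γ / t ^ (2 * β)) * ‖x‖ ^ 2) ^ ((k : ℝ) / ((k : ℝ) - 1))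
          = (C - (γ / t ^ (2 * β)) * ‖x‖ ^ 2) ^ ((k : ℝ) / ((k : ℝ) - 1) - 1)
            * (C - (γ / t ^ (2 * β)) * ‖x‖ ^ 2) := by
        rw [Real.rpow_sub_one hF.ne', div_mul_cancel₀ _ hF.ne']
      have hQ2 : (C - (γ / t ^ (2 * β)) * ‖x‖ ^ 2) ^ ((k : ℝ) / ((k : ℝ) - 1) - 2)
          = (C - (γ / t ^ (2 * β)) * ‖x‖ ^ 2) ^ ((k : ℝ) / ((k : ℝ) - 1) - 1)
            / (C - (γ / t ^ (2 * β)) * ‖x‖ ^ 2) := by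
        rw [← Real.rpow_sub_one hF.ne']; congr 1; ring
      have hQ3 : ((C - (γ / t ^ (2 * β)) * ‖x‖ ^ 2) ^ ((k : ℝ) / ((k : ℝ) - 1) - 1)) ^ (k - 1)
          = C - (γ / t ^ (2 * β)) * ‖x‖ ^ 2 := by
        rw [← Real.rpow_natCast, ← Real.rpow_mul hF.le, Nat.cast_sub (by omega)]
        have : ((k : ℝ) / ((k : ℝ) - 1) - 1) * ((k : ℝ) - ((1 : ℕ) : ℝ)) = 1 := by
          push_cast; field_simp; ring
        rw [this, Real.rpow_one]
      rw [hQ1, hQ2]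
      have hmk : ((k : ℝ) / ((k : ℝ) - 1) - 1) * k = (k : ℝ) / ((k : ℝ) - 1) := by
        field_simp; ring
      rw [hα]
      rw [hα] at hK
      generalize (C - (γ / t ^ (2 * β)) * ‖x‖ ^ 2) ^ ((k : ℝ) / ((k : ℝ) - 1) - 1) = Q at *
      generalize (C - (γ / t ^ (2 * β)) * ‖x‖ ^ 2) = F at *
      generalize (γ / t ^ (2 * β)) = g at *
      generalize t ^ (-(n * β)) = A at *
      generalize (k : ℝ) / ((k : ℝ) - 1) = m at *
      generalize ‖x‖ ^ 2 = X at *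
      have ha : (-2 * g * m * A * Q) ^ (k - 1) = (-1) ^ (k - 1) * (2 * g * m * A) ^ (k - 1) * F := by
        rw [← hQ3, ← mul_pow, ← mul_pow]; congr 1; ring
      rw [ha]
      have hs : ((-1 : ℝ) ^ (k - 1)) * (-1) ^ (k - 1) = 1 := by
        rw [← mul_pow]; simp
      have hkk : (2 * g * m * A) ^ k = (2 * g * m * A) ^ (k - 1) * (2 * g * m * A) := by
        rw [← pow_succ]; congr 1; omega
      rw [hkk] at hK
      generalize (2 * g * m * A) ^ (k - 1) = P at *
      have r : (-1 : ℝ) ^ (k - 1) * ((n.choose k : ℝ) * ((-1) ^ (k - 1) * P * F) *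
          (-2 * g * m * A * Q + 4 * g ^ 2 * m * (m - 1) * A * (Q / F) * (k / n) * X))
          = ((n.choose k : ℝ) * (P * (2 * g * m * A))) *
            (-(Q * F) + 2 * g * ((m - 1) * k) / n * Q * X) := by
        calc _ = (((-1 : ℝ) ^ (k - 1)) * (-1) ^ (k - 1)) * ((n.choose k : ℝ) * (P * F) *
          (-2 * g * m * A * Q + 4 * g ^ 2 * m * (m - 1) * A * (Q / F) * (k / n) * X)) := by ring
          _ = _ := by
            rw [hs]
            field_simp
            ring
      rw [r, hK, hmk]
      field_simp
    · have hF : C - (γ / t ^ (2 * β)) * ‖x‖ ^ 2 < 0 := by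
        rw [div_mul_eq_mul_div]; linarith
      rw [hUt, hess_zero n k (by omega) _ _ _ _ hm.ne' x hF, mul_zero]
      refine (hasDerivAt_const t (0 : ℝ)).congr_of_eventuallyEq ?_
      filter_upwards [hFt.continuousAt.eventually
          (gt_mem_nhds (show C - γ * ‖x‖ ^ 2 / t ^ (2 * β) < 0 by linarith))] with s hs
      simp only [U]
      rw [max_eq_right hs.le, Real.zero_rpow hm.ne', mul_zero]
  · intro t ht
    have hT : 0 < t ^ β := Real.rpow_pos_of_pos ht _
    have hr : 0 < t ^ β * Real.sqrt (C / γ) := by positivity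
    rw [← closure_ball _ hr.ne']
    congr 1
    ext x
    have hnn : 0 ≤ U t x := by
      simp only [U]
      have : 0 < t ^ (-α) := Real.rpow_pos_of_pos ht _
      positivity
    rw [Function.mem_support, mem_ball_zero_iff, ← hnn.lt_iff_ne', hpos t ht x,
      ← sq_lt_sq₀ (norm_nonneg _) hr.le, mul_pow, Real.sq_sqrt (by positivity)]
    have : t ^ (2 * β) = (t ^ β) ^ 2 := by
      rw [← Real.rpow_natCast, ← Real.rpow_mul ht.le]; congr 1; push_cast; ring
    rw [this, ← mul_div_assoc, lt_div_iff₀ hγ, mul_comm (‖x‖ ^ 2), mul_comm C]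
end
end

section
/- Let n ≥ 2, let k be an integer with 2 ≤ k ≤ n, and set c_{n,k} = (1/n)·binom(n,k), α = n/(n(k−1)+2k), β = 1/(n(k−1)+2k) and γ = ((k−1)/(2k))·(β/c_{n,k})^{1/k}. For C > 0, let U_C(t,x) = t^{−α} ( C − γ |x|² / t^{2β} )₊^{k/(k−1)} for t > 0 and x ∈ ℝⁿ, where (·)₊ denotes the positive part. Then for every t > 0 the function U_C(t,·) is integrable on ℝⁿ and its total mass M = ∫_{ℝⁿ} U_C(t,x) dx is finite, positive and independent of t (mass conservation); moreover, for every bounded continuous function φ on ℝⁿ, ∫_{ℝⁿ} U_C(t,x) φ(x) dx → M·φ(0) as t → 0⁺, i.e. U_C(t,·) converges to M times the Dirac delta at the origin as t → 0⁺. -/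
open scoped BigOperators
open Metric Set MeasureTheory Filter

noncomputable section

theorem barenblatt_aux (n : ℕ) (C γ p β α : ℝ) (hC : 0 < C) (hγ : 0 < γ) (hp : 0 < p)
    (hβ : 0 < β) (hα : α = n * β) :
    let U : ℝ → EuclideanSpace ℝ (Fin n) → ℝ := fun t x =>
      t ^ (-α) * max (C - γ * ‖x‖ ^ 2 / t ^ (2 * β)) 0 ^ p
    ∃ M : ℝ, 0 < M ∧
      (∀ t : ℝ, 0 < t → Integrable (U t) volume ∧ (∫ x, U t x) = M) ∧
      (∀ φ : BoundedContinuousFunction (EuclideanSpace ℝ (Fin n)) ℝ,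
        Tendsto (fun t : ℝ => ∫ x, U t x * φ x)
          (nhdsWithin 0 (Ioi (0 : ℝ))) (nhds (M * φ 0))) := by
  intro U
  let F : EuclideanSpace ℝ (Fin n) → ℝ := fun y => max (C - γ * ‖y‖ ^ 2) 0 ^ p
  have hFc : Continuous F := by
    apply Continuous.rpow_const
    · fun_prop
    · intro x; right; exact hp.le
  have hF0 : ∀ y, 0 ≤ F y := fun y => Real.rpow_nonneg (le_max_right _ _) _
  have hFs : HasCompactSupport F := by
    refine HasCompactSupport.intro (isCompact_closedBall (0 : EuclideanSpace ℝ (Fin n)) (1 + C / γ)) ?_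
    intro x hx
    have hx' : 1 + C / γ < ‖x‖ := by simpa using hx
    have h0 : 0 < C / γ := by positivity
    have h1 : C / γ ≤ ‖x‖ ^ 2 := by nlinarith
    have h2 : C ≤ γ * ‖x‖ ^ 2 := by
      rw [div_le_iff₀ hγ] at h1; linarith
    simp only [F]
    rw [max_eq_right (by linarith), Real.zero_rpow hp.ne']
  have hFi : Integrable F volume := hFc.integrable_of_hasCompactSupport hFs
  have hM : 0 < ∫ y, F y := by
    refine hFc.integral_pos_of_hasCompactSupport_nonneg_nonzero hFs hF0 (x := 0) ?_
    simp only [F]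
    have : max (C - γ * ‖(0 : EuclideanSpace ℝ (Fin n))‖ ^ 2) 0 = C := by simp [hC.le]
    rw [this]
    exact (Real.rpow_pos_of_pos hC p).ne'
  have hU : ∀ t : ℝ, 0 < t → ∀ x, U t x = (t ^ (-β)) ^ n * F (t ^ (-β) • x) := by
    intro t ht x
    have h1 : t ^ (-α) = (t ^ (-β)) ^ n := by
      rw [← Real.rpow_natCast, ← Real.rpow_mul ht.le, hα]; congr 1; ring
    have h2 : γ * ‖x‖ ^ 2 / t ^ (2 * β) = γ * ‖t ^ (-β) • x‖ ^ 2 := by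
      rw [norm_smul, Real.norm_of_nonneg (Real.rpow_nonneg ht.le _), mul_pow,
        ← Real.rpow_natCast (t ^ (-β)), ← Real.rpow_mul ht.le, div_eq_mul_inv,
        ← Real.rpow_neg ht.le]
      have : -β * ((2 : ℕ) : ℝ) = -(2 * β) := by push_cast; ring
      rw [this]; ring
    simp only [U, F]
    rw [h1, h2]
  have key : ∀ t : ℝ, 0 < t → ∀ φ : EuclideanSpace ℝ (Fin n) → ℝ,
      ∫ x, U t x * φ x = ∫ y, F y * φ (t ^ β • y) := by
    intro t ht φ
    have hR : 0 < t ^ (-β) := Real.rpow_pos_of_pos ht _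
    have e : ∀ x, U t x * φ x
        = (t ^ (-β)) ^ n * (fun y => F y * φ (t ^ β • y)) (t ^ (-β) • x) := by
      intro x
      have : t ^ β • t ^ (-β) • x = x := by
        rw [smul_smul, ← Real.rpow_add ht]; simp
      simp only [this]
      rw [hU t ht]; ring
    rw [integral_congr_ae (Eventually.of_forall e), integral_const_mul,
      Measure.integral_comp_smul volume (fun y => F y * φ (t ^ β • y)) (t ^ (-β))]
    rw [abs_of_pos (by positivity), finrank_euclideanSpace, Fintype.card_fin, smul_eq_mul,
      ← mul_assoc, mul_inv_cancel₀ (by positivity), one_mul]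
  refine ⟨∫ y, F y, hM, ?_, ?_⟩
  · intro t ht
    constructor
    · have : U t = fun x => (t ^ (-β)) ^ n * F (t ^ (-β) • x) := funext (hU t ht)
      rw [this]
      exact (hFi.comp_smul (Real.rpow_pos_of_pos ht _).ne').const_mul _
    · simpa using key t ht (fun _ => 1)
  · intro φ
    have hT : Tendsto (fun t : ℝ => ∫ y, F y * φ (t ^ β • y)) (nhdsWithin 0 (Ioi (0 : ℝ)))
        (nhds (∫ y, F y * φ 0)) := by
      refine tendsto_integral_filter_of_dominated_convergence (fun y => F y * ‖φ‖) ?_ ?_ ?_ ?_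
      · refine Eventually.of_forall fun t => Continuous.aestronglyMeasurable ?_
        exact hFc.mul (φ.continuous.comp (continuous_const_smul _))
      · refine Eventually.of_forall fun t => Eventually.of_forall fun y => ?_
        rw [norm_mul, Real.norm_of_nonneg (hF0 y)]
        exact mul_le_mul_of_nonneg_left (φ.norm_coe_le_norm _) (hF0 y)
      · exact hFi.mul_const _
      · refine Eventually.of_forall fun y => ?_
        refine Tendsto.const_mul _ ?_
        have h1 : Tendsto (fun t : ℝ => t ^ β) (nhdsWithin 0 (Ioi (0 : ℝ))) (nhds 0) := by
          have := (Real.continuousAt_rpow_const 0 β (Or.inr hβ.le)).tendsto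
          rw [Real.zero_rpow hβ.ne'] at this
          exact this.mono_left nhdsWithin_le_nhds
        have h2 : Tendsto (fun t : ℝ => t ^ β • y) (nhdsWithin 0 (Ioi (0 : ℝ))) (nhds 0) := by
          simpa using h1.smul_const y
        exact (φ.continuous.tendsto 0).comp h2
    rw [integral_mul_const] at hT
    refine hT.congr' ?_
    filter_upwards [self_mem_nhdsWithin] with t ht
    exact (key t ht φ).symm

/-- the `k`-Barenblatt function `U_C` is integrable in `x` for each `t > 0`,
with total mass `M` finite, positive and independent of `t` (mass conservation), and
`U_C(t,·) → M δ₀` weakly (against bounded continuous functions) as `t → 0⁺`. -/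
theorem stmt_19 (n k : ℕ) (hn : 2 ≤ n) (hk : 2 ≤ k) (hkn : k ≤ n) (C : ℝ) (hC : 0 < C) :
    let cnk : ℝ := (1 : ℝ) / (n : ℝ) * (n.choose k : ℝ)
    let α : ℝ := (n : ℝ) / ((n : ℝ) * ((k : ℝ) - 1) + 2 * (k : ℝ))
    let β : ℝ := 1 / ((n : ℝ) * ((k : ℝ) - 1) + 2 * (k : ℝ))
    let γ : ℝ := ((k : ℝ) - 1) / (2 * (k : ℝ)) * (β / cnk) ^ ((1 : ℝ) / (k : ℝ))
    let U : ℝ → EuclideanSpace ℝ (Fin n) → ℝ := fun t x =>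
      t ^ (-α) * max (C - γ * ‖x‖ ^ 2 / t ^ (2 * β)) 0 ^ ((k : ℝ) / ((k : ℝ) - 1))
    ∃ M : ℝ, 0 < M ∧
      (∀ t : ℝ, 0 < t → Integrable (U t) volume ∧ (∫ x, U t x) = M) ∧
      (∀ φ : BoundedContinuousFunction (EuclideanSpace ℝ (Fin n)) ℝ,
        Tendsto (fun t : ℝ => ∫ x, U t x * φ x)
          (nhdsWithin 0 (Ioi (0 : ℝ))) (nhds (M * φ 0))) := by
  intro cnk α β γ
  have hn' : (2 : ℝ) ≤ n := by exact_mod_cast hn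
  have hk' : (2 : ℝ) ≤ k := by exact_mod_cast hk
  have hk1 : (0 : ℝ) < (k : ℝ) - 1 := by linarith
  have hD : (0 : ℝ) < (n : ℝ) * ((k : ℝ) - 1) + 2 * (k : ℝ) := by
    have : (0 : ℝ) < (n : ℝ) * ((k : ℝ) - 1) := mul_pos (by linarith) hk1
    linarith
  have hβ : 0 < β := one_div_pos.mpr hD
  have hch : (0 : ℝ) < n.choose k := by exact_mod_cast Nat.choose_pos hkn
  have hc : 0 < cnk := mul_pos (one_div_pos.mpr (by linarith)) hch
  have hγ : 0 < γ :=
    mul_pos (div_pos hk1 (by linarith)) (Real.rpow_pos_of_pos (div_pos hβ hc) _)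
  exact barenblatt_aux n C γ _ β α hC hγ (div_pos (by linarith) hk1) hβ
    (by simp only [α, β]; ring)
end
end
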